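/- arXiv:1704.00173 — 3 statements merged into one kernel-verified Lean document; each statement's English description precedes it below -/
import Mathlib

section
/- Let (P^t)_{t≥0} be a Markov contraction semigroup on B with generator L, and let f ∈ D(L). For t > 0 and x ∈ ℝ^d define v(t,x) := ∫_ℝ (2πt)^{−1/2} e^{−u²/(2t)} P^{|u|} f(x) du. Then for every t > 0 the function v(t,·) belongs to D(L²), for every x the map t ↦ v(t,x) is differentiable on (0,∞), and ∂_t v(t,x) = (2πt)^{−1/2} (L f)(x) + (1/2) (L² v(t,·))(x) for all t > 0 and x ∈ ℝ^d. -/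
open MeasureTheory Filter Topology
open scoped ENNReal

noncomputable section

instance : Fact ((1:ℝ≥0∞) ≤ ⊤) := ⟨le_top⟩

abbrev BddFun (α : Type) : Type := lp (fun _ : α => ℝ) ⊤

structure MarkovSemigroup (α : Type) where
  P : ℝ → BddFun α →ₗ[ℝ] BddFun α
  id_zero : P 0 = LinearMap.id
  comp' : ∀ s t : ℝ, 0 ≤ s → 0 ≤ t → P (s + t) = (P s).comp (P t)
  pos' : ∀ t : ℝ, 0 ≤ t → ∀ f : BddFun α, (∀ x, 0 ≤ f x) → ∀ x, 0 ≤ (P t f) x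
  contract' : ∀ t : ℝ, 0 ≤ t → ∀ f : BddFun α, ‖P t f‖ ≤ ‖f‖

def genLimit {α : Type} (S : MarkovSemigroup α) (f g : BddFun α) : Prop :=
  Tendsto (fun h : ℝ => h⁻¹ • (S.P h f - f)) (nhdsWithin 0 (Set.Ioi 0)) (nhds g)

def memDom {α : Type} (S : MarkovSemigroup α) (f : BddFun α) : Prop :=
  ∃ g, genLimit S f g

open scoped Classical in
noncomputable def MarkovSemigroup.gen {α : Type} (S : MarkovSemigroup α) (f : BddFun α) :
    BddFun α :=
  if h : memDom S f then h.choose else 0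

def memB0 {α : Type} (S : MarkovSemigroup α) (f : BddFun α) : Prop :=
  Tendsto (fun t : ℝ => S.P t f) (nhdsWithin 0 (Set.Ioi 0)) (nhds f)

def memDomIter {α : Type} (S : MarkovSemigroup α) : ℕ → BddFun α → Prop
  | 0, f => memB0 S f
  | n+1, f => memDomIter S n f ∧ memDom S (S.gen^[n] f)

namespace MarkovSemigroup

variable {α : Type} (S : MarkovSemigroup α) {f g f' g' : BddFun α}

lemma genLimit_unique (h : genLimit S f g) (h' : genLimit S f g') : g = g' :=
  tendsto_nhds_unique h h'

lemma gen_eq_of_genLimit (h : genLimit S f g) : S.gen f = g := by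
  have hd : memDom S f := ⟨g, h⟩
  rw [gen, dif_pos hd]
  exact S.genLimit_unique hd.choose_spec h

lemma genLimit_gen (h : memDom S f) : genLimit S f (S.gen f) := by
  obtain ⟨g, hg⟩ := h
  rwa [S.gen_eq_of_genLimit hg]

lemma genLimit_add (h : genLimit S f g) (h' : genLimit S f' g') :
    genLimit S (f + f') (g + g') := by
  refine (Tendsto.add h h').congr fun t => ?_
  rw [map_add, ← smul_add]
  congr 1
  abel

lemma genLimit_smul (c : ℝ) (h : genLimit S f g) : genLimit S (c • f) (c • g) := by
  refine (Tendsto.const_smul h c).congr fun t => ?_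
  rw [map_smul, ← smul_sub, smul_comm]

/-- The operator `P t`, for `t ≥ 0`, as a continuous linear map. -/
def clm (t : ℝ) (ht : 0 ≤ t) : BddFun α →L[ℝ] BddFun α :=
  (S.P t).mkContinuous 1 fun f => by simpa using S.contract' t ht f

lemma clm_apply (t : ℝ) (ht : 0 ≤ t) (f : BddFun α) : S.clm t ht f = S.P t f := rfl

lemma P_add_apply {s t : ℝ} (hs : 0 ≤ s) (ht : 0 ≤ t) (f : BddFun α) :
    S.P (s + t) f = S.P s (S.P t f) := by
  rw [S.comp' s t hs ht]; rfl

lemma P_zero_apply (f : BddFun α) : S.P 0 f = f := by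
  rw [S.id_zero]; rfl

lemma tendsto_P_zero (h : genLimit S f g) :
    Tendsto (fun t => S.P t f) (𝓝[>] 0) (𝓝 f) := by
  have h1 : Tendsto (fun t : ℝ => t) (𝓝[>] 0) (𝓝 0) := nhdsWithin_le_nhds
  have h2 := (h1.smul h).add_const f
  rw [zero_smul, zero_add] at h2
  refine h2.congr' ?_
  filter_upwards [self_mem_nhdsWithin] with t ht
  rw [smul_inv_smul₀ (ne_of_gt ht), sub_add_cancel]

lemma norm_P_sub_le {s t : ℝ} (hs : 0 ≤ s) (hst : s ≤ t) (f : BddFun α) :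
    ‖S.P t f - S.P s f‖ ≤ ‖S.P (t - s) f - f‖ := by
  have h : S.P t f = S.P s (S.P (t - s) f) := by
    rw [← S.P_add_apply hs (sub_nonneg.2 hst), add_sub_cancel]
  rw [h, ← map_sub]
  exact S.contract' s hs _

lemma continuousOn_P_of_genLimit (h : genLimit S f g) :
    ContinuousOn (fun t => S.P t f) (Set.Ici 0) := by
  have h0 : Tendsto (fun t => S.P t f) (𝓝[≥] 0) (𝓝 f) := by
    rw [← Set.Ioi_insert, nhdsWithin_insert, tendsto_sup]
    refine ⟨?_, S.tendsto_P_zero h⟩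
    have := tendsto_pure_nhds (fun t => S.P t f) 0
    rwa [S.P_zero_apply] at this
  rw [Metric.continuousOn_iff]
  intro t ht ε hε
  rw [Metric.tendsto_nhdsWithin_nhds] at h0
  obtain ⟨δ, hδ, H⟩ := h0 ε hε
  refine ⟨δ, hδ, fun s hs hst => ?_⟩
  rw [Set.mem_Ici] at hs ht
  rw [Real.dist_eq] at hst
  rcases le_total s t with hle | hle
  · rw [dist_comm, dist_eq_norm]
    refine (S.norm_P_sub_le hs hle f).trans_lt ?_
    rw [← dist_eq_norm]
    refine H (sub_nonneg.2 hle) ?_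
    rwa [Real.dist_eq, sub_zero, abs_sub_comm]
  · rw [dist_eq_norm]
    refine (S.norm_P_sub_le ht hle f).trans_lt ?_
    rw [← dist_eq_norm]
    refine H (sub_nonneg.2 hle) ?_
    rwa [Real.dist_eq, sub_zero]

lemma continuousOn_P_gen (h : genLimit S f g) :
    ContinuousOn (fun t => S.P t g) (Set.Ici 0) := by
  have hu : TendstoUniformlyOn (fun (r : ℝ) t => S.P t (r⁻¹ • (S.P r f - f)))
      (fun t => S.P t g) (𝓝[>] 0) (Set.Ici 0) := by
    rw [Metric.tendstoUniformlyOn_iff]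
    intro ε hε
    filter_upwards [(Metric.tendsto_nhds.1 h) ε hε] with r hr t ht
    rw [dist_comm, dist_eq_norm, ← map_sub]
    exact (S.contract' t ht _).trans_lt (by rwa [← dist_eq_norm])
  refine hu.continuousOn (Eventually.frequently ?_)
  filter_upwards [self_mem_nhdsWithin] with r hr
  rw [Set.mem_Ioi] at hr
  have hc := S.continuousOn_P_of_genLimit h
  have hc' : ContinuousOn (fun t => S.P (t + r) f) (Set.Ici 0) :=
    hc.comp (f := fun t : ℝ => t + r) (by fun_prop)
      fun t (ht : 0 ≤ t) => Set.mem_Ici.2 (by linarith)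
  refine ((hc'.sub hc).const_smul r⁻¹).congr fun t ht => ?_
  rw [map_smul, map_sub, ← S.P_add_apply ht hr.le]
  rfl

lemma hasDerivWithinAt_P (h : genLimit S f g) {t : ℝ} (ht : 0 ≤ t) :
    HasDerivWithinAt (fun t => S.P t f) (S.P t g) (Set.Ioi t) t := by
  rw [hasDerivWithinAt_iff_tendsto_slope' (Set.self_notMem_Ioi)]
  have h1 : Tendsto (fun s : ℝ => s - t) (𝓝[>] t) (𝓝[>] 0) := by
    refine tendsto_nhdsWithin_iff.2 ⟨?_, ?_⟩
    · have : Tendsto (fun s : ℝ => s - t) (𝓝 t) (𝓝 (t - t)) :=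
        (continuous_id.sub continuous_const).tendsto t
      rw [sub_self] at this
      exact this.mono_left nhdsWithin_le_nhds
    · filter_upwards [self_mem_nhdsWithin] with s hs
      exact Set.mem_Ioi.2 (sub_pos.2 (Set.mem_Ioi.1 hs))
  have h2 := ((S.clm t ht).continuous.tendsto g).comp (Tendsto.comp h h1)
  refine h2.congr' ?_
  filter_upwards [self_mem_nhdsWithin] with s hs
  rw [Set.mem_Ioi] at hs
  simp only [Function.comp_apply, clm_apply, slope, vsub_eq_sub]
  rw [map_smul, map_sub, ← S.P_add_apply ht (sub_nonneg.2 hs.le), add_sub_cancel]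

lemma integrableOn_smul_P {k : ℝ → ℝ} (hk : IntegrableOn k (Set.Ioi 0))
    (hc : ContinuousOn (fun t => S.P t f) (Set.Ici 0)) :
    IntegrableOn (fun u => k u • S.P u f) (Set.Ioi 0) := by
  refine Integrable.mono' (hk.norm.mul_const ‖f‖) (hk.aestronglyMeasurable.smul
    ((hc.mono Set.Ioi_subset_Ici_self).aestronglyMeasurable measurableSet_Ioi)) ?_
  filter_upwards [ae_restrict_mem measurableSet_Ioi] with u hu
  rw [norm_smul]
  exact mul_le_mul_of_nonneg_left (S.contract' u (le_of_lt hu) f) (norm_nonneg _)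

lemma genLimit_integral {k : ℝ → ℝ} (hk : IntegrableOn k (Set.Ioi 0)) (h : genLimit S f g) :
    genLimit S (∫ u in Set.Ioi 0, k u • S.P u f) (∫ u in Set.Ioi 0, k u • S.P u g) := by
  have hf := S.integrableOn_smul_P hk (S.continuousOn_P_of_genLimit h)
  have hg := S.integrableOn_smul_P hk (S.continuousOn_P_gen h)
  rw [genLimit, tendsto_iff_norm_sub_tendsto_zero]
  have h0 : Tendsto (fun r : ℝ => (∫ u in Set.Ioi 0, ‖k u‖) * ‖r⁻¹ • (S.P r f - f) - g‖)
      (𝓝[>] 0) (𝓝 0) := by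
    have := (tendsto_iff_norm_sub_tendsto_zero.1 h).const_mul (∫ u in Set.Ioi 0, ‖k u‖)
    rwa [mul_zero] at this
  refine squeeze_zero' (Eventually.of_forall fun _ => norm_nonneg _) ?_ h0
  filter_upwards [self_mem_nhdsWithin] with r hr
  rw [Set.mem_Ioi] at hr
  have hPf : IntegrableOn (fun u => S.clm r hr.le (k u • S.P u f)) (Set.Ioi 0) :=
    (S.clm r hr.le).integrable_comp hf
  have hsub : Integrable (fun u => r⁻¹ • (S.clm r hr.le (k u • S.P u f) - k u • S.P u f))
      (volume.restrict (Set.Ioi 0)) := (hPf.sub hf).smul r⁻¹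
  have key : r⁻¹ • (S.P r (∫ u in Set.Ioi 0, k u • S.P u f) - ∫ u in Set.Ioi 0, k u • S.P u f)
      - ∫ u in Set.Ioi 0, k u • S.P u g
      = ∫ u in Set.Ioi 0, k u • S.P u (r⁻¹ • (S.P r f - f) - g) := by
    rw [← S.clm_apply r hr.le, ← ContinuousLinearMap.integral_comp_comm _ hf,
      ← integral_sub hPf hf, ← integral_smul, ← integral_sub hsub hg]
    refine setIntegral_congr_fun measurableSet_Ioi fun u hu => ?_
    have hu0 : 0 ≤ u := le_of_lt hu
    simp only [clm_apply, map_sub, map_smul]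
    rw [← S.P_add_apply hr.le hu0, ← S.P_add_apply hu0 hr.le, add_comm r u]
    module
  rw [key, ← integral_mul_const]
  refine norm_integral_le_of_norm_le (hk.norm.mul_const _) ?_
  filter_upwards [ae_restrict_mem measurableSet_Ioi] with u hu
  rw [norm_smul]
  exact mul_le_mul_of_nonneg_left (S.contract' u (le_of_lt hu) _) (norm_nonneg _)

lemma integral_smul_P_gen {k k' : ℝ → ℝ} (hd : ∀ u, HasDerivAt k (k' u) u)
    (hk : IntegrableOn k (Set.Ioi 0)) (hk' : IntegrableOn k' (Set.Ioi 0))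
    (h : genLimit S f g) :
    ∫ u in Set.Ioi 0, k u • S.P u g = -(k 0 • f) - ∫ u in Set.Ioi 0, k' u • S.P u f := by
  have hcf := S.continuousOn_P_of_genLimit h
  have hf := S.integrableOn_smul_P hk' hcf
  have hg := S.integrableOn_smul_P hk (S.continuousOn_P_gen h)
  have hk0 : Tendsto k atTop (𝓝 0) :=
    tendsto_zero_of_hasDerivAt_of_integrableOn_Ioi (fun u _ => hd u) hk' hk
  have hkc : Continuous k := continuous_iff_continuousAt.2 fun u => (hd u).continuousAt
  have hF0 : Tendsto (fun u => k u • S.P u f - k 0 • f) atTop (𝓝 (0 - k 0 • f)) := by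
    refine Tendsto.sub_const ?_ _
    have hb : Tendsto (fun u => ‖k u‖ * ‖f‖) atTop (𝓝 0) := by
      simpa using hk0.norm.mul_const ‖f‖
    refine squeeze_zero_norm' ?_ hb
    filter_upwards [eventually_ge_atTop 0] with u hu
    rw [norm_smul]
    exact mul_le_mul_of_nonneg_left (S.contract' u hu f) (norm_nonneg _)
  have hlim := intervalIntegral_tendsto_integral_Ioi 0 (hg.add hf) tendsto_id
  have heq : ∫ u in Set.Ioi 0, (k u • S.P u g + k' u • S.P u f) = 0 - k 0 • f := by
    refine tendsto_nhds_unique hlim (hF0.congr' ?_)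
    filter_upwards [eventually_ge_atTop 0] with b hb
    have := intervalIntegral.integral_eq_sub_of_hasDeriv_right_of_le
      (f := fun u => k u • S.P u f) (f' := fun u => k u • S.P u g + k' u • S.P u f) hb
      (hkc.continuousOn.smul (hcf.mono Set.Icc_subset_Ici_self))
      (fun u hu => (hd u).hasDerivWithinAt.smul (S.hasDerivWithinAt_P h hu.1.le))
      ((intervalIntegrable_iff_integrableOn_Ioc_of_le hb).2
        ((hg.add hf).mono_set Set.Ioc_subset_Ioi_self))
    rw [S.P_zero_apply] at this
    exact this.symm
  rw [integral_add hg hf] at heq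
  rw [eq_sub_iff_add_eq, heq, zero_sub]

end MarkovSemigroup

section HeatDensity

/-- The density at `u` of the centered Gaussian law with variance `t`. -/
def heatDensity (t u : ℝ) : ℝ := (Real.sqrt (2 * Real.pi * t))⁻¹ * Real.exp (-u ^ 2 / (2 * t))

lemma heatDensity_zero (t : ℝ) : heatDensity t 0 = (Real.sqrt (2 * Real.pi * t))⁻¹ := by
  simp [heatDensity]

lemma hasDerivAt_heatDensity {t : ℝ} (ht : t ≠ 0) (u : ℝ) :
    HasDerivAt (heatDensity t) (-(u / t) * heatDensity t u) u := by
  have h := ((((hasDerivAt_id u).pow 2).neg.div_const (2 * t)).exp).const_mul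
    (Real.sqrt (2 * Real.pi * t))⁻¹
  refine h.congr_deriv ?_
  simp only [heatDensity, id, Pi.neg_apply, Pi.pow_apply]
  field_simp
  norm_num

lemma hasDerivAt_deriv_heatDensity {t : ℝ} (ht : t ≠ 0) (u : ℝ) :
    HasDerivAt (fun u => -(u / t) * heatDensity t u)
      ((u ^ 2 / t ^ 2 - 1 / t) * heatDensity t u) u := by
  have h := (((hasDerivAt_id u).div_const t).neg).mul (hasDerivAt_heatDensity ht u)
  refine h.congr_deriv ?_
  simp only [id, Pi.neg_apply]
  field_simp
  ring

lemma hasDerivAt_heatDensity_time {t : ℝ} (ht : 0 < t) (u : ℝ) :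
    HasDerivAt (fun t => heatDensity t u)
      (1 / 2 * ((u ^ 2 / t ^ 2 - 1 / t) * heatDensity t u)) t := by
  have hpi : 0 < 2 * Real.pi * t := by positivity
  have hs := (((hasDerivAt_id t).const_mul (2 * Real.pi)).sqrt hpi.ne').inv
    (Real.sqrt_pos.2 hpi).ne'
  have he := ((hasDerivAt_const t (-u ^ 2)).div ((hasDerivAt_id t).const_mul 2)
    (by simpa using ht.ne')).exp
  refine (hs.mul he).congr_deriv ?_
  simp only [heatDensity, id, Pi.div_apply, Pi.inv_apply]
  have hsq : Real.sqrt (2 * Real.pi * t) ^ 2 = 2 * Real.pi * t := Real.sq_sqrt hpi.le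
  have hs0 : Real.sqrt (2 * Real.pi * t) ≠ 0 := (Real.sqrt_pos.2 hpi).ne'
  rw [hsq]
  field_simp
  ring

lemma integrable_pow_mul_exp_neg_mul_sq {b : ℝ} (hb : 0 < b) (n : ℕ) :
    Integrable fun u : ℝ => u ^ n * Real.exp (-b * u ^ 2) := by
  have hn : (-1 : ℝ) < n := by linarith [Nat.cast_nonneg (α := ℝ) n]
  simpa [Real.rpow_natCast] using integrable_rpow_mul_exp_neg_mul_sq hb hn

lemma integrable_pow_mul_heatDensity {t : ℝ} (ht : 0 < t) (n : ℕ) :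
    Integrable fun u => u ^ n * heatDensity t u := by
  have h := (integrable_pow_mul_exp_neg_mul_sq (b := 1 / (2 * t)) (by positivity) n).const_mul
    (Real.sqrt (2 * Real.pi * t))⁻¹
  refine h.congr (Eventually.of_forall fun u => ?_)
  have : -(1 / (2 * t)) * u ^ 2 = -u ^ 2 / (2 * t) := by ring
  simp only [heatDensity, this]
  ring

lemma integrable_heatDensity {t : ℝ} (ht : 0 < t) : Integrable (heatDensity t) := by
  simpa using integrable_pow_mul_heatDensity ht 0

lemma integrable_deriv_heatDensity {t : ℝ} (ht : 0 < t) :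
    Integrable fun u => -(u / t) * heatDensity t u := by
  refine ((integrable_pow_mul_heatDensity ht 1).const_mul (-1 / t)).congr
    (Eventually.of_forall fun u => ?_)
  ring

lemma integrable_deriv_deriv_heatDensity {t : ℝ} (ht : 0 < t) :
    Integrable fun u => (u ^ 2 / t ^ 2 - 1 / t) * heatDensity t u := by
  refine (((integrable_pow_mul_heatDensity ht 2).const_mul (1 / t ^ 2)).sub
    ((integrable_heatDensity ht).const_mul (1 / t))).congr (Eventually.of_forall fun u => ?_)
  simp only [Pi.sub_apply]
  ring

lemma abs_deriv_heatDensity_time_le {s t : ℝ} (ht : 0 < t) (hs : s ∈ Set.Ioo (t / 2) (2 * t))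
    (u : ℝ) :
    |1 / 2 * ((u ^ 2 / s ^ 2 - 1 / s) * heatDensity s u)| ≤
      (u ^ 2 / (t / 2) ^ 2 + 1 / (t / 2)) *
        ((Real.sqrt (2 * Real.pi * (t / 2)))⁻¹ * Real.exp (-(1 / (4 * t)) * u ^ 2)) := by
  obtain ⟨h1, h2⟩ := hs
  have ht2 : 0 < t / 2 := by positivity
  have hs0 : 0 < s := ht2.trans h1
  have hp : 0 ≤ heatDensity s u := by unfold heatDensity; positivity
  have hp' : heatDensity s u ≤
      (Real.sqrt (2 * Real.pi * (t / 2)))⁻¹ * Real.exp (-(1 / (4 * t)) * u ^ 2) := by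
    unfold heatDensity
    have hsqrt : 0 < Real.sqrt (2 * Real.pi * (t / 2)) := Real.sqrt_pos.2 (by positivity)
    refine mul_le_mul ?_ ?_ (Real.exp_pos _).le (by positivity)
    · have := h1.le
      gcongr
    · refine Real.exp_le_exp.2 ?_
      have : u ^ 2 / (4 * t) ≤ u ^ 2 / (2 * s) :=
        div_le_div_of_nonneg_left (sq_nonneg u) (by positivity) (by linarith)
      calc -u ^ 2 / (2 * s) = -(u ^ 2 / (2 * s)) := by ring
        _ ≤ -(u ^ 2 / (4 * t)) := neg_le_neg this
        _ = _ := by ring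
  have hc : |u ^ 2 / s ^ 2 - 1 / s| ≤ u ^ 2 / (t / 2) ^ 2 + 1 / (t / 2) := by
    have ha : u ^ 2 / s ^ 2 ≤ u ^ 2 / (t / 2) ^ 2 := by gcongr
    have hb : 1 / s ≤ 1 / (t / 2) := by gcongr
    have ha' : 0 ≤ u ^ 2 / s ^ 2 := by positivity
    have hb' : 0 ≤ 1 / s := by positivity
    rw [abs_le]
    constructor <;> linarith
  rw [abs_mul, abs_mul, abs_of_nonneg hp, abs_of_pos (by norm_num : (0 : ℝ) < 1 / 2)]
  have := mul_le_mul hc hp' hp (by positivity)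
  have h0 : 0 ≤ |u ^ 2 / s ^ 2 - 1 / s| * heatDensity s u := by positivity
  linarith

end HeatDensity

lemma MarkovSemigroup.hasDerivAt_integral_heatDensity {α : Type} (S : MarkovSemigroup α)
    {f g : BddFun α} (h : genLimit S f g) (x : α) {t : ℝ} (ht : 0 < t) :
    HasDerivAt (fun s => ∫ u in Set.Ioi 0, heatDensity s u * (S.P u f) x)
      (∫ u in Set.Ioi 0, 1 / 2 * ((u ^ 2 / t ^ 2 - 1 / t) * heatDensity t u) * (S.P u f) x) t := by
  have hcf := S.continuousOn_P_of_genLimit h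
  have hint : ∀ k : ℝ → ℝ, Integrable k →
      Integrable (fun u => k u * (S.P u f) x) (volume.restrict (Set.Ioi 0)) := fun k hk =>
    (lp.evalCLM ℝ (fun _ : α => ℝ) ⊤ x).integrable_comp
      (S.integrableOn_smul_P hk.integrableOn hcf)
  have hbound : Integrable fun u : ℝ => (u ^ 2 / (t / 2) ^ 2 + 1 / (t / 2)) *
      ((Real.sqrt (2 * Real.pi * (t / 2)))⁻¹ * Real.exp (-(1 / (4 * t)) * u ^ 2)) := by
    have hb : 0 < 1 / (4 * t) := by positivity
    refine (((integrable_pow_mul_exp_neg_mul_sq hb 2).const_mul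
      ((Real.sqrt (2 * Real.pi * (t / 2)))⁻¹ / (t / 2) ^ 2)).add
      ((integrable_pow_mul_exp_neg_mul_sq hb 0).const_mul
      ((Real.sqrt (2 * Real.pi * (t / 2)))⁻¹ / (t / 2)))).congr (Eventually.of_forall fun u => ?_)
    simp only [Pi.add_apply]
    ring
  refine (hasDerivAt_integral_of_dominated_loc_of_deriv_le
    (s := Set.Ioo (t / 2) (2 * t))
    (F' := fun s u => 1 / 2 * ((u ^ 2 / s ^ 2 - 1 / s) * heatDensity s u) * (S.P u f) x)
    (Ioo_mem_nhds (by linarith) (by linarith)) ?_ (hint _ (integrable_heatDensity ht))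
    (hint _ ((integrable_deriv_deriv_heatDensity ht).const_mul _)).aestronglyMeasurable ?_
    (hbound.integrableOn.mul_const ‖f‖) ?_).2
  · filter_upwards [Ioi_mem_nhds ht] with s hs
    exact (hint _ (integrable_heatDensity hs)).aestronglyMeasurable
  · filter_upwards [ae_restrict_mem measurableSet_Ioi] with u hu s hs
    rw [norm_mul]
    have hx : ‖(S.P u f) x‖ ≤ ‖f‖ :=
      (lp.norm_apply_le_norm ENNReal.top_ne_zero _ x).trans (S.contract' u (le_of_lt hu) f)
    have hb := abs_deriv_heatDensity_time_le ht hs u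
    exact mul_le_mul hb hx (norm_nonneg _) ((abs_nonneg _).trans hb)
  · filter_upwards with u s hs
    exact (hasDerivAt_heatDensity_time (by linarith [hs.1]) u).mul_const _

theorem stmt_5 (d : ℕ) (hd : 1 ≤ d)
    (S : MarkovSemigroup (Fin d → ℝ))
    (f : BddFun (Fin d → ℝ)) (hf : memDom S f)
    (v : ℝ → BddFun (Fin d → ℝ))
    (hv : ∀ t : ℝ, 0 < t → ∀ x, (v t) x =
      ∫ u : ℝ, (Real.sqrt (2 * Real.pi * t))⁻¹ * Real.exp (-u^2 / (2*t)) * (S.P |u| f) x) :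
    ∀ t : ℝ, 0 < t →
      (memDom S (v t) ∧ memDom S (S.gen (v t))) ∧
      ∀ x, DifferentiableAt ℝ (fun s => (v s) x) t ∧
        deriv (fun s => (v s) x) t =
          (Real.sqrt (2 * Real.pi * t))⁻¹ * (S.gen f) x
            + (1/2) * (S.gen (S.gen (v t))) x := by
  intro t ht
  have hfg := S.genLimit_gen hf
  set g := S.gen f
  have hcf := S.continuousOn_P_of_genLimit hfg
  have heval : ∀ (k : ℝ → ℝ), Integrable k → ∀ x,
      (∫ u in Set.Ioi 0, k u • S.P u f : BddFun (Fin d → ℝ)) x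
        = ∫ u in Set.Ioi 0, k u * (S.P u f) x := fun k hk x =>
    ((lp.evalCLM ℝ (fun _ : Fin d → ℝ => ℝ) ⊤ x).integral_comp_comm
      (S.integrableOn_smul_P hk.integrableOn hcf)).symm
  have hvs : ∀ s, 0 < s → ∀ x, v s x = 2 * ∫ u in Set.Ioi 0, heatDensity s u * (S.P u f) x := by
    intro s hs x
    rw [hv s hs x, ← integral_comp_abs (f := fun u => heatDensity s u * (S.P u f) x)]
    simp only [heatDensity, sq_abs]
  have hvt : v t = (2 : ℝ) • ∫ u in Set.Ioi 0, heatDensity t u • S.P u f := by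
    ext x
    rw [hvs t ht x, lp.coeFn_smul, Pi.smul_apply, heval _ (integrable_heatDensity ht), smul_eq_mul]
  have i0 := (integrable_heatDensity ht).integrableOn (s := Set.Ioi 0)
  have i1 := (integrable_deriv_heatDensity ht).integrableOn (s := Set.Ioi 0)
  have i2 := (integrable_deriv_deriv_heatDensity ht).integrableOn (s := Set.Ioi 0)
  have hL := S.genLimit_smul 2 (S.genLimit_integral i0 hfg)
  rw [← hvt, S.integral_smul_P_gen (hasDerivAt_heatDensity ht.ne') i0 i1 hfg] at hL
  have hL2 := S.genLimit_smul 2 (S.genLimit_add (S.genLimit_smul (-heatDensity t 0) hfg)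
    (S.genLimit_smul (-1) (S.genLimit_integral i1 hfg)))
  rw [S.integral_smul_P_gen (hasDerivAt_deriv_heatDensity ht.ne') i1 i2 hfg, neg_smul _ f,
    neg_one_smul, ← sub_eq_add_neg, ← S.gen_eq_of_genLimit hL] at hL2
  refine ⟨⟨⟨_, hL⟩, ⟨_, hL2⟩⟩, fun x => ?_⟩
  have hder : HasDerivAt (fun s => v s x) _ t :=
    ((S.hasDerivAt_integral_heatDensity hfg x ht).const_mul 2).congr_of_eventuallyEq
      (by filter_upwards [Ioi_mem_nhds ht] with s hs using hvs s hs x)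
  refine ⟨hder.differentiableAt, ?_⟩
  rw [hder.deriv, S.gen_eq_of_genLimit hL2, ← heatDensity_zero]
  have hx := heval _ (integrable_deriv_deriv_heatDensity ht) x
  simp only [mul_assoc (1 / 2 : ℝ), integral_const_mul, lp.coeFn_smul, lp.coeFn_add, lp.coeFn_sub,
    lp.coeFn_neg, Pi.smul_apply, Pi.add_apply, Pi.sub_apply, Pi.neg_apply, smul_eq_mul, hx]
  simp
end
end

section
/- For every ξ > 0 and every t > 0: (1/√π) ∫₀^t ∂_u [ e^{−ξ²/(4u)} / √(4πu) ] · (t−u)^{−1/2} du = ξ e^{−ξ²/(4t)} / ( 4 √π t^{3/2} ). In other words, the Caputo fractional derivative of order 1/2 in t of the heat kernel t ↦ e^{−ξ²/(4t)}/√(4πt) equals ξ e^{−ξ²/(4t)}/(4√π t^{3/2}). -/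
noncomputable section

lemma hasDerivAt_heatKernel (xi u : ℝ) (hu : 0 < u) :
    HasDerivAt (fun w => Real.exp (-xi^2 / (4*w)) / Real.sqrt (4 * Real.pi * w))
      (Real.exp (-xi^2 / (4*u)) * (xi^2 / (4*u^2) - 1 / (2*u)) / Real.sqrt (4 * Real.pi * u)) u := by
  have hpos : 0 < 4 * Real.pi * u := by positivity
  have hlin : HasDerivAt (fun w : ℝ => 4 * w) 4 u := by
    simpa using (hasDerivAt_id u).const_mul (4:ℝ)
  have hexp := ((hasDerivAt_const u (-xi^2)).div hlin (by positivity)).exp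
  have hlin' : HasDerivAt (fun w : ℝ => 4 * Real.pi * w) (4 * Real.pi) u := by
    simpa using (hasDerivAt_id u).const_mul (4 * Real.pi)
  have hsqrt := hlin'.sqrt hpos.ne'
  have hs : 0 < Real.sqrt (4 * Real.pi * u) := Real.sqrt_pos.mpr hpos
  refine (hexp.div hsqrt hs.ne').congr_deriv ?_
  have hsq : Real.sqrt (4 * Real.pi * u) ^ 2 = 4 * Real.pi * u := Real.sq_sqrt hpos.le
  simp only [Pi.div_apply]
  generalize Real.sqrt (4 * Real.pi * u) = s at *
  have hpi := Real.pi_pos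
  have hpi_eq : Real.pi = s ^ 2 / (4 * u) := by field_simp; linarith
  rw [hpi_eq]
  field_simp
  ring

lemma hasDerivAt_mul_exp_neg_mul_sq (a v : ℝ) :
    HasDerivAt (fun v : ℝ => -(1 / 2) * (v * Real.exp (-a * v^2)))
      (Real.exp (-a * v^2) * (a * v^2 - 1 / 2)) v := by
  have hexp := (((hasDerivAt_id v).pow 2).const_mul (-a)).exp
  refine (((hasDerivAt_id v).mul hexp).const_mul (-(1 / 2))).congr_deriv ?_
  simp
  ring

lemma integrable_sq_mul_exp_neg_mul_sq {a : ℝ} (ha : 0 < a) :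
    MeasureTheory.Integrable (fun v : ℝ => v^2 * Real.exp (-a * v^2)) := by
  simpa using integrable_rpow_mul_exp_neg_mul_sq ha (s := 2) (by norm_num)

lemma integrable_exp_neg_mul_sq_mul_sub {a : ℝ} (ha : 0 < a) :
    MeasureTheory.Integrable (fun v : ℝ => Real.exp (-a * v^2) * (a * v^2 - 1 / 2)) := by
  refine (((integrable_sq_mul_exp_neg_mul_sq ha).const_mul a).sub
    ((integrable_exp_neg_mul_sq ha).const_mul (1 / 2))).congr (.of_forall fun v => ?_)
  simp only [Pi.sub_apply]
  ring

lemma integral_Ioi_exp_neg_mul_sq_mul_sub {a : ℝ} (ha : 0 < a) :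
    ∫ v in Set.Ioi (0:ℝ), Real.exp (-a * v^2) * (a * v^2 - 1 / 2) = 0 := by
  have hint := (integrable_exp_neg_mul_sq_mul_sub ha).integrableOn (s := Set.Ioi 0)
  have htend := MeasureTheory.tendsto_zero_of_hasDerivAt_of_integrableOn_Ioi (a := 0)
    (fun v _ => hasDerivAt_mul_exp_neg_mul_sq a v) hint
    ((integrable_mul_exp_neg_mul_sq ha).const_mul (-(1 / 2))).integrableOn
  rw [MeasureTheory.integral_Ioi_of_hasDerivAt_of_tendsto'
    (fun v _ => hasDerivAt_mul_exp_neg_mul_sq a v) hint htend]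
  simp

lemma integral_Ioi_exp_neg_mul_sq_mul_add {a : ℝ} (ha : 0 < a) (b : ℝ) :
    ∫ v in Set.Ioi (0:ℝ), Real.exp (-a * v^2) * (b + a * v^2 - 1 / 2) =
      b * (Real.sqrt (Real.pi / a) / 2) := by
  have hsplit : ∀ v : ℝ, Real.exp (-a * v^2) * (b + a * v^2 - 1 / 2) =
      b * Real.exp (-a * v^2) + Real.exp (-a * v^2) * (a * v^2 - 1 / 2) := fun v => by ring
  simp_rw [hsplit]
  rw [MeasureTheory.integral_add ((integrable_exp_neg_mul_sq ha).const_mul b).integrableOn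
    (integrable_exp_neg_mul_sq_mul_sub ha).integrableOn, integral_Ioi_exp_neg_mul_sq_mul_sub ha,
    MeasureTheory.integral_const_mul, integral_gaussian_Ioi, add_zero]

lemma image_div_one_add_mul_sq {t : ℝ} (ht : 0 < t) :
    (fun v : ℝ => t / (1 + t * v^2)) '' Set.Ioi 0 = Set.Ioo 0 t := by
  ext u
  constructor
  · rintro ⟨v, hv, rfl⟩
    have hv : 0 < v := hv
    refine ⟨by positivity, ?_⟩
    exact div_lt_self ht (by have : 0 < t * v^2 := by positivity
                             linarith)
  · rintro ⟨hu, hut⟩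
    have hpos : 0 < (t - u) / (t * u) := div_pos (sub_pos.mpr hut) (by positivity)
    refine ⟨Real.sqrt ((t - u) / (t * u)), Real.sqrt_pos.mpr hpos, ?_⟩
    simp only
    rw [Real.sq_sqrt hpos.le]
    field_simp
    ring

lemma injOn_div_one_add_mul_sq {t : ℝ} (ht : 0 < t) :
    Set.InjOn (fun v : ℝ => t / (1 + t * v^2)) (Set.Ioi 0) := by
  intro v hv w hw h
  have hv : 0 < v := hv
  have hw : 0 < w := hw
  simp only at h
  rw [div_eq_div_iff (by positivity) (by positivity)] at h
  have h1 := mul_left_cancel₀ ht.ne' h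
  have h2 : v^2 = w^2 := mul_left_cancel₀ ht.ne' (by linarith)
  exact (pow_left_inj₀ hv.le hw.le two_ne_zero).mp h2

lemma hasDerivAt_div_one_add_mul_sq {t : ℝ} (ht : 0 < t) (v : ℝ) :
    HasDerivAt (fun v : ℝ => t / (1 + t * v^2)) (-(2 * t^2 * v / (1 + t * v^2)^2)) v := by
  have hden := ((((hasDerivAt_id v).pow 2).const_mul t).const_add 1)
  have hne : 1 + t * v^2 ≠ 0 := by positivity
  refine ((hasDerivAt_const v t).div hden (by simpa using hne)).congr_deriv ?_
  simp
  field_simp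

lemma heatKernel_substitution {xi t v : ℝ} (ht : 0 < t) (hv : 0 < v) :
    |-(2 * t^2 * v / (1 + t * v^2)^2)| •
      (deriv (fun w => Real.exp (-xi^2 / (4*w)) / Real.sqrt (4 * Real.pi * w))
        (t / (1 + t * v^2)) * (Real.sqrt (t - t / (1 + t * v^2)))⁻¹) =
    Real.exp (-xi^2 / (4*t)) / (Real.sqrt Real.pi * Real.sqrt t) *
      (Real.exp (-(xi^2 / 4) * v^2) * (xi^2 / (4*t) + xi^2 / 4 * v^2 - 1 / 2)) := by
  have hD : 0 < 1 + t * v^2 := by positivity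
  rw [(hasDerivAt_heatKernel xi _ (by positivity)).deriv, abs_neg, abs_of_pos (by positivity),
    smul_eq_mul]
  have hsub : t - t / (1 + t * v^2) = (t * v)^2 / (1 + t * v^2) := by field_simp; ring
  have hkern : 4 * Real.pi * (t / (1 + t * v^2)) = 2^2 * (Real.pi * t) / (1 + t * v^2) := by
    ring
  have hexp : Real.exp (-xi^2 / (4 * (t / (1 + t * v^2)))) =
      Real.exp (-xi^2 / (4*t)) * Real.exp (-(xi^2 / 4) * v^2) := by
    rw [← Real.exp_add]
    congr 1
    field_simp
    ring
  have hpi := Real.pi_pos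
  rw [hexp, hsub, hkern, Real.sqrt_div (by positivity), Real.sqrt_div (by positivity),
    Real.sqrt_sq (by positivity), Real.sqrt_mul (by positivity), Real.sqrt_sq (by positivity),
    Real.sqrt_mul hpi.le]
  have hr : 0 < Real.sqrt (1 + t * v^2) := Real.sqrt_pos.mpr hD
  have hrsq : Real.sqrt (1 + t * v^2) ^ 2 = 1 + t * v^2 := Real.sq_sqrt hD.le
  have hp : 0 < Real.sqrt Real.pi := Real.sqrt_pos.mpr hpi
  have hst : 0 < Real.sqrt t := Real.sqrt_pos.mpr ht
  generalize Real.sqrt (1 + t * v^2) = r at *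
  generalize Real.sqrt Real.pi = p at *
  generalize Real.sqrt t = s at *
  generalize Real.exp (-xi^2 / (4*t)) = A
  generalize Real.exp (-(xi^2 / 4) * v^2) = B
  field_simp
  rw [hrsq]
  ring

theorem stmt_11 (xi t : ℝ) (hxi : 0 < xi) (ht : 0 < t) :
    (1 / Real.sqrt Real.pi) *
      ∫ u in (0:ℝ)..t,
        deriv (fun w => Real.exp (-xi^2 / (4*w)) / Real.sqrt (4 * Real.pi * w)) u *
          (Real.sqrt (t - u))⁻¹ =
    xi * Real.exp (-xi^2 / (4*t)) / (4 * Real.sqrt Real.pi * t ^ ((3:ℝ)/2)) := by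
  rw [intervalIntegral.integral_of_le ht.le, MeasureTheory.integral_Ioc_eq_integral_Ioo,
    ← image_div_one_add_mul_sq ht,
    MeasureTheory.integral_image_eq_integral_abs_deriv_smul measurableSet_Ioi
      (fun v _ => (hasDerivAt_div_one_add_mul_sq ht v).hasDerivWithinAt)
      (injOn_div_one_add_mul_sq ht),
    MeasureTheory.setIntegral_congr_fun measurableSet_Ioi
      (fun v hv => heatKernel_substitution ht hv),
    MeasureTheory.integral_const_mul, integral_Ioi_exp_neg_mul_sq_mul_add (by positivity)]
  have hpow : t ^ ((3:ℝ)/2) = t * Real.sqrt t := by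
    rw [Real.sqrt_eq_rpow, ← Real.rpow_one_add' ht.le (by norm_num)]
    norm_num
  have hsqrt : Real.sqrt (Real.pi / (xi^2 / 4)) = 2 * Real.sqrt Real.pi / xi := by
    rw [show Real.pi / (xi^2 / 4) = 2^2 * Real.pi / xi^2 by field_simp; norm_num,
      Real.sqrt_div (by positivity), Real.sqrt_mul (by positivity), Real.sqrt_sq (by positivity),
      Real.sqrt_sq hxi.le]
  have hp : 0 < Real.sqrt Real.pi := Real.sqrt_pos.mpr Real.pi_pos
  have hst : 0 < Real.sqrt t := Real.sqrt_pos.mpr ht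
  rw [hpow, hsqrt]
  field_simp
end
end

section
/- Let v : [0,∞) → ℝ be bounded and measurable. For u > 0 and ξ ≥ 0 set K(u,ξ) := e^{−ξ²/(4u)} / √(4πu), and define w(u) := 2 ∫₀^∞ K(u,ξ) v(ξ) dξ. Fix t > 0 and assume: (i) w is differentiable on (0,t] with w′(u) = 2 ∫₀^∞ ∂_u K(u,ξ) v(ξ) dξ; (ii) ∫₀^t ∫₀^∞ |∂_u K(u,ξ)| · |v(ξ)| · (t−u)^{−1/2} dξ du < ∞. Then (1/√π) ∫₀^t w′(u) (t−u)^{−1/2} du = ( 1 / (2 √π t^{3/2}) ) ∫₀^∞ ξ e^{−ξ²/(4t)} v(ξ) dξ; that is, the Caputo derivative of order 1/2 of w at t equals (1/(2√π t^{3/2})) ∫₀^∞ ξ e^{−ξ²/(4t)} v(ξ) dξ. -/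
open MeasureTheory

noncomputable section

theorem hasDerivAt_heatKernel_time {u : ℝ} (hu : 0 < u) (ξ : ℝ) :
    HasDerivAt (fun r : ℝ => Real.exp (-ξ ^ 2 / (4 * r)) / Real.sqrt (4 * Real.pi * r))
      ((ξ ^ 2 / (4 * u ^ 2) - 1 / (2 * u)) *
        (Real.exp (-ξ ^ 2 / (4 * u)) / Real.sqrt (4 * Real.pi * u))) u := by
  have hpos : 0 < 4 * Real.pi * u := by positivity
  have hs : Real.sqrt (4 * Real.pi * u) ≠ 0 := (Real.sqrt_pos.2 hpos).ne'
  have h1 : HasDerivAt (fun r : ℝ => -ξ ^ 2 / (4 * r)) (ξ ^ 2 / (4 * u ^ 2)) u := by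
    have := (hasDerivAt_const u (-ξ ^ 2)).div ((hasDerivAt_id u).const_mul 4)
      (by simpa using hu.ne')
    refine this.congr_deriv ?_
    simp only [id]
    field_simp
    ring
  have h2 : HasDerivAt (fun r : ℝ => Real.sqrt (4 * Real.pi * r))
      (4 * Real.pi / (2 * Real.sqrt (4 * Real.pi * u))) u := by
    simpa using ((hasDerivAt_id u).const_mul (4 * Real.pi)).sqrt hpos.ne'
  refine (h1.exp.div h2 hs).congr_deriv ?_
  have hsq := Real.sq_sqrt hpos.le
  set s := Real.sqrt (4 * Real.pi * u)
  have hpi : Real.pi = s ^ 2 / (4 * u) := by rw [hsq]; field_simp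
  rw [hpi]
  field_simp

theorem image_div_one_add_sq_Ioi {t : ℝ} (ht : 0 < t) :
    (fun x : ℝ => t / (1 + x ^ 2)) '' Set.Ioi 0 = Set.Ioo 0 t := by
  ext u
  constructor
  · rintro ⟨x, hx, rfl⟩
    have hx : 0 < x := hx
    exact ⟨by positivity, (div_lt_self ht (by nlinarith))⟩
  · rintro ⟨h0, h1⟩
    have hq : 0 < t / u - 1 := by rw [sub_pos, lt_div_iff₀ h0]; linarith
    refine ⟨Real.sqrt (t / u - 1), Real.sqrt_pos.2 hq, ?_⟩
    simp only [Real.sq_sqrt hq.le]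
    field_simp
    ring

theorem injOn_div_one_add_sq_Ioi {t : ℝ} (ht : 0 < t) :
    Set.InjOn (fun x : ℝ => t / (1 + x ^ 2)) (Set.Ioi 0) := by
  intro x hx y hy h
  have hx : 0 < x := hx
  have hy : 0 < y := hy
  simp only at h
  rw [div_eq_div_iff (by positivity) (by positivity)] at h
  have h2 : y ^ 2 = x ^ 2 := by linarith [mul_left_cancel₀ ht.ne' h]
  exact ((sq_eq_sq₀ hy.le hx.le).1 h2).symm

theorem hasDerivAt_div_one_add_sq (t x : ℝ) :
    HasDerivAt (fun x : ℝ => t / (1 + x ^ 2)) (-(2 * t * x) / (1 + x ^ 2) ^ 2) x := by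
  have h := (hasDerivAt_const x t).div (((hasDerivAt_id x).pow 2).const_add 1)
    (show (1 + id x ^ 2 : ℝ) ≠ 0 by simp only [id]; positivity)
  refine h.congr_deriv ?_
  simp
  ring

theorem integrable_sq_mul_gaussian {a : ℝ} (ha : 0 < a) :
    Integrable (fun x : ℝ => x ^ 2 * Real.exp (-a * x ^ 2)) := by
  have := integrable_rpow_mul_exp_neg_mul_sq ha (s := 2) (by norm_num)
  simpa using this

theorem integral_Ioi_mul_gaussian {a : ℝ} (ha : 0 < a) :
    ∫ x in Set.Ioi (0 : ℝ), (2 * a * (1 + x ^ 2) - 1) * Real.exp (-a * x ^ 2) =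
      Real.sqrt (Real.pi * a) := by
  have hg := integrable_exp_neg_mul_sq ha
  have hs := integrable_sq_mul_gaussian ha
  have hd : Integrable (fun x : ℝ => (2 * a * x ^ 2 - 1) * Real.exp (-a * x ^ 2)) := by
    refine ((hs.const_mul (2 * a)).sub hg).congr (.of_forall fun x => ?_)
    simp only [Pi.sub_apply]
    ring
  have hlim : Filter.Tendsto (fun x : ℝ => -(x * Real.exp (-a * x ^ 2))) Filter.atTop (nhds 0) := by
    have h := (rpow_mul_exp_neg_mul_sq_isLittleO_exp_neg ha 1).isBigO.trans_tendsto
      (Real.tendsto_exp_atBot.comp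
        (Filter.tendsto_id.const_mul_atTop_of_neg (show (-(1 / 2) : ℝ) < 0 by norm_num)))
    simpa using h.neg
  have h0 : ∫ x in Set.Ioi (0 : ℝ), (2 * a * x ^ 2 - 1) * Real.exp (-a * x ^ 2) = 0 := by
    have h := integral_Ioi_of_hasDerivAt_of_tendsto' (a := (0 : ℝ))
      (f := fun x : ℝ => -(x * Real.exp (-a * x ^ 2))) (fun x _ => ?_) hd.integrableOn hlim
    · simpa using h
    · have h2 : HasDerivAt (fun x : ℝ => -a * x ^ 2) (-a * (2 * x)) x := by
        simpa using (hasDerivAt_pow 2 x).const_mul (-a)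
      refine ((hasDerivAt_id x).mul h2.exp).neg.congr_deriv ?_
      simp only [id]
      ring
  calc
    _ = ∫ x in Set.Ioi (0 : ℝ), (2 * a * Real.exp (-a * x ^ 2) +
          (2 * a * x ^ 2 - 1) * Real.exp (-a * x ^ 2)) := by
        congr 1 with x
        ring
    _ = 2 * a * (Real.sqrt (Real.pi / a) / 2) := by
        rw [integral_add (hg.const_mul _).integrableOn hd.integrableOn, h0, integral_const_mul,
          integral_gaussian_Ioi, add_zero]
    _ = Real.sqrt (Real.pi * a) := by
        rw [show Real.pi * a = a ^ 2 * (Real.pi / a) by field_simp,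
          Real.sqrt_mul (sq_nonneg a), Real.sqrt_sq ha.le]
        ring

/-- The Caputo derivative of order `1/2` of the heat kernel in time, up to the factor `1 / √π`. -/
theorem integral_heatKernel_time_deriv_mul_inv_sqrt {t ξ : ℝ} (ht : 0 < t) (hξ : 0 < ξ) :
    ∫ u in Set.Ioc 0 t, ((ξ ^ 2 / (4 * u ^ 2) - 1 / (2 * u)) *
        (Real.exp (-ξ ^ 2 / (4 * u)) / Real.sqrt (4 * Real.pi * u))) * (Real.sqrt (t - u))⁻¹ =
      ξ * Real.exp (-ξ ^ 2 / (4 * t)) / (4 * t ^ ((3 : ℝ) / 2)) := by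
  have ha : 0 < ξ ^ 2 / (4 * t) := by positivity
  rw [integral_Ioc_eq_integral_Ioo, ← image_div_one_add_sq_Ioi ht,
    integral_image_eq_integral_abs_deriv_smul measurableSet_Ioi
      (fun x _ => (hasDerivAt_div_one_add_sq t x).hasDerivWithinAt) (injOn_div_one_add_sq_Ioi ht)]
  have key : ∀ x ∈ Set.Ioi (0 : ℝ), |-(2 * t * x) / (1 + x ^ 2) ^ 2| •
      (((ξ ^ 2 / (4 * (t / (1 + x ^ 2)) ^ 2) - 1 / (2 * (t / (1 + x ^ 2)))) *
        (Real.exp (-ξ ^ 2 / (4 * (t / (1 + x ^ 2)))) /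
          Real.sqrt (4 * Real.pi * (t / (1 + x ^ 2))))) *
        (Real.sqrt (t - t / (1 + x ^ 2)))⁻¹) =
      Real.exp (-ξ ^ 2 / (4 * t)) / (2 * Real.sqrt Real.pi * t) *
        ((2 * (ξ ^ 2 / (4 * t)) * (1 + x ^ 2) - 1) * Real.exp (-(ξ ^ 2 / (4 * t)) * x ^ 2)) := by
    intro x hx
    have hx : 0 < x := hx
    have hy : 0 < 1 + x ^ 2 := by positivity
    have hexp : Real.exp (-ξ ^ 2 / (4 * (t / (1 + x ^ 2)))) =
        Real.exp (-ξ ^ 2 / (4 * t)) * Real.exp (-(ξ ^ 2 / (4 * t)) * x ^ 2) := by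
      rw [← Real.exp_add]
      congr 1
      field_simp
      ring
    have hsqrt : Real.sqrt (4 * Real.pi * (t / (1 + x ^ 2))) * Real.sqrt (t - t / (1 + x ^ 2)) =
        2 * Real.sqrt Real.pi * (t * x / (1 + x ^ 2)) := by
      rw [← Real.sqrt_mul (by positivity),
        show 4 * Real.pi * (t / (1 + x ^ 2)) * (t - t / (1 + x ^ 2)) =
          (2 * (t * x / (1 + x ^ 2))) ^ 2 * Real.pi by field_simp; ring,
        Real.sqrt_mul (sq_nonneg _), Real.sqrt_sq (by positivity)]
      ring
    rw [neg_div, abs_neg, abs_of_pos (by positivity), smul_eq_mul, hexp, mul_assoc _ (_ / _),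
      ← div_eq_mul_inv, div_div, hsqrt]
    have hpi : Real.sqrt Real.pi ≠ 0 := (Real.sqrt_pos.2 Real.pi_pos).ne'
    field_simp
  rw [setIntegral_congr_fun measurableSet_Ioi key, integral_const_mul,
    integral_Ioi_mul_gaussian ha, Real.sqrt_mul Real.pi_pos.le, Real.sqrt_div (sq_nonneg ξ),
    Real.sqrt_sq hξ.le, Real.sqrt_mul (by norm_num), show (4 : ℝ) = 2 ^ 2 by norm_num,
    Real.sqrt_sq (by norm_num), show (3 : ℝ) / 2 = 1 + 1 / 2 by norm_num, Real.rpow_add ht,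
    Real.rpow_one, ← Real.sqrt_eq_rpow]
  have hpi : Real.sqrt Real.pi ≠ 0 := (Real.sqrt_pos.2 Real.pi_pos).ne'
  have hst : Real.sqrt t ≠ 0 := (Real.sqrt_pos.2 ht).ne'
  field_simp

theorem stmt_12 (v : ℝ → ℝ) (hvmeas : Measurable v) (hvbdd : ∃ C : ℝ, ∀ ξ, |v ξ| ≤ C)
    (K : ℝ → ℝ → ℝ)
    (hK : ∀ u ξ, K u ξ = Real.exp (-ξ^2 / (4*u)) / Real.sqrt (4 * Real.pi * u))
    (w : ℝ → ℝ) (hw : ∀ u, w u = 2 * ∫ ξ in Set.Ioi (0:ℝ), K u ξ * v ξ)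
    (t : ℝ) (ht : 0 < t)
    (hderiv : ∀ u : ℝ, 0 < u → u ≤ t →
      HasDerivAt w (2 * ∫ ξ in Set.Ioi (0:ℝ), deriv (fun r => K r ξ) u * v ξ) u)
    (hint : IntegrableOn
      (fun q : ℝ × ℝ => deriv (fun r => K r q.2) q.1 * v q.2 * (Real.sqrt (t - q.1))⁻¹)
      ((Set.Ioc 0 t) ×ˢ (Set.Ioi 0))) :
    (1 / Real.sqrt Real.pi) * ∫ u in (0:ℝ)..t, deriv w u * (Real.sqrt (t - u))⁻¹ =
      (1 / (2 * Real.sqrt Real.pi * t ^ ((3:ℝ)/2))) *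
        ∫ ξ in Set.Ioi (0:ℝ), ξ * Real.exp (-ξ^2 / (4*t)) * v ξ := by
  have hdK : ∀ u, 0 < u → ∀ ξ, deriv (fun r => K r ξ) u =
      (ξ ^ 2 / (4 * u ^ 2) - 1 / (2 * u)) *
        (Real.exp (-ξ ^ 2 / (4 * u)) / Real.sqrt (4 * Real.pi * u)) := by
    intro u hu ξ
    simp only [hK]
    exact (hasDerivAt_heatKernel_time hu ξ).deriv
  have hint' : Integrable
      (Function.uncurry fun u ξ => deriv (fun r => K r ξ) u * v ξ * (Real.sqrt (t - u))⁻¹)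
      ((volume.restrict (Set.Ioc 0 t)).prod (volume.restrict (Set.Ioi 0))) := by
    rw [Measure.prod_restrict]
    exact hint
  have hleft : ∫ u in Set.Ioc 0 t, deriv w u * (Real.sqrt (t - u))⁻¹ =
      2 * ∫ u in Set.Ioc 0 t, ∫ ξ in Set.Ioi (0 : ℝ),
        deriv (fun r => K r ξ) u * v ξ * (Real.sqrt (t - u))⁻¹ := by
    rw [← integral_const_mul]
    refine setIntegral_congr_fun measurableSet_Ioc fun u hu => ?_
    simp only [(hderiv u hu.1 hu.2).deriv, integral_mul_const]
    ring
  have hright : ∀ ξ ∈ Set.Ioi (0 : ℝ),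
      ∫ u in Set.Ioc 0 t, deriv (fun r => K r ξ) u * v ξ * (Real.sqrt (t - u))⁻¹ =
        1 / (4 * t ^ ((3 : ℝ) / 2)) * (ξ * Real.exp (-ξ ^ 2 / (4 * t)) * v ξ) := by
    intro ξ hξ
    calc
      _ = ∫ u in Set.Ioc 0 t, v ξ * (((ξ ^ 2 / (4 * u ^ 2) - 1 / (2 * u)) *
          (Real.exp (-ξ ^ 2 / (4 * u)) / Real.sqrt (4 * Real.pi * u))) *
            (Real.sqrt (t - u))⁻¹) := by
        refine setIntegral_congr_fun measurableSet_Ioc fun u hu => ?_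
        simp only [hdK u hu.1 ξ]
        ring
      _ = _ := by
        rw [integral_const_mul, integral_heatKernel_time_deriv_mul_inv_sqrt ht hξ]
        ring
  rw [intervalIntegral.integral_of_le ht.le, hleft, integral_integral_swap hint',
    setIntegral_congr_fun measurableSet_Ioi hright, integral_const_mul]
  ring
end
end
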